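/- arXiv:1511.02801 — 4 statements merged into one kernel-verified Lean document; each statement's English description precedes it below -/
import Mathlib

section
/- Let G1 = (V1, E1) and G2 = (V2, E2) be finite simple graphs that are edge-disjoint, let G = G1 ∪ G2 be their union, let S = V1 ∩ V2, and let a be length constraints on S satisfying the triangle inequalities. If F1 ⊆ E1 is an a-bounded S-multicut of G1 and F2 ⊆ E2 is an a-bounded S-multicut of G2, then F1 ∪ F2 is an a-bounded S-multicut of G. -/
open SimpleGraph

/-- `F` is an `a`-bounded `S`-multicut of `G`: `F` is a set of edges of `G` such that
after deleting `F`, the distance between any two distinct terminals `s, t ∈ S`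
is at least `a s t` (distance being `⊤` when no path exists). -/
def IsLBMulticut {V : Type*} (G : SimpleGraph V) (S : Set V) (a : V → V → ℕ)
    (F : Set (Sym2 V)) : Prop :=
  F ⊆ G.edgeSet ∧
    ∀ s ∈ S, ∀ t ∈ S, s ≠ t → (a s t : ℕ∞) ≤ (G.deleteEdges F).edist s t

/-- Let `b` satisfy the triangle inequality on `S` and bound from below, on `S`, the distances in
each graph of a family whose vertex sets pairwise meet inside `S`. Then prefixing a walk of the
union by a shortest path in one member of the family gives length at least `b`. -/
lemma le_edist_add_length_of_iSup {V ι : Type*} {H : ι → SimpleGraph V} {W : ι → Set V}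
    (hW : ∀ i, (H i).support ⊆ W i) {S : Set V} (hS : ∀ i j, i ≠ j → W i ∩ W j ⊆ S)
    {b : V → V → ℕ} (htri : ∀ s ∈ S, ∀ u ∈ S, ∀ t ∈ S, b s t ≤ b s u + b u t)
    (hb : ∀ i, ∀ s ∈ S, ∀ t ∈ S, (b s t : ℕ∞) ≤ (H i).edist s t)
    {v t : V} (p : (⨆ i, H i).Walk v t) (ht : t ∈ S) (i : ι) (hv : v ∈ W i)
    {s : V} (hs : s ∈ S) : (b s t : ℕ∞) ≤ (H i).edist s v + p.length := by
  induction p generalizing i s with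
  | nil => simpa using hb i s hs _ ht
  | @cons v w t h p ih =>
    obtain ⟨j, hj⟩ := SimpleGraph.iSup_adj.mp h
    have hvw : (H j).edist v w ≤ 1 := (edist_eq_one_iff_adj.mpr hj).le
    have hvj : v ∈ W j := hW j ⟨w, hj⟩
    have hwj : w ∈ W j := hW j ⟨v, hj.symm⟩
    rw [Walk.length_cons, Nat.cast_add, Nat.cast_one, add_comm (p.length : ℕ∞) 1]
    by_cases hij : i = j
    · subst hij
      calc (b s t : ℕ∞) ≤ (H i).edist s w + p.length := ih ht i hwj hs
        _ ≤ ((H i).edist s v + 1) + p.length := by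
          gcongr
          exact SimpleGraph.edist_triangle.trans (by gcongr)
        _ = _ := add_assoc _ _ _
    · have hvS : v ∈ S := hS i j hij ⟨hv, hvj⟩
      calc (b s t : ℕ∞) ≤ b s v + b v t := mod_cast htri s hs v hvS t ht
        _ ≤ (H i).edist s v + ((H j).edist v w + p.length) :=
          add_le_add (hb i s hs v hvS) (ih ht j hwj hvS)
        _ ≤ _ := by gcongr

/-- If `G₁` and `G₂` are edge-disjoint finite graphs (with vertex sets `V₁`, `V₂`),
`S = V₁ ∩ V₂`, the length constraints `a` satisfy the triangle inequalities on `S`,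
`F₁` is an `a`-bounded `S`-multicut of `G₁` and `F₂` is an `a`-bounded `S`-multicut
of `G₂`, then `F₁ ∪ F₂` is an `a`-bounded `S`-multicut of `G = G₁ ∪ G₂`. -/
theorem multicut_union_of_edgeDisjoint {V : Type*} [Fintype V]
    (G₁ G₂ : SimpleGraph V) (V₁ V₂ : Set V)
    (hV₁ : G₁.support ⊆ V₁) (hV₂ : G₂.support ⊆ V₂)
    (hdisj : Disjoint G₁.edgeSet G₂.edgeSet)
    (S : Set V) (hS : S = V₁ ∩ V₂)
    (a : V → V → ℕ) (hsym : ∀ s t, a s t = a t s)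
    (htri : ∀ s ∈ S, ∀ t ∈ S, ∀ u ∈ S, s ≠ t → s ≠ u → t ≠ u → a s t ≤ a s u + a u t)
    (F₁ F₂ : Set (Sym2 V))
    (hF₁ : IsLBMulticut G₁ S a F₁) (hF₂ : IsLBMulticut G₂ S a F₂) :
    IsLBMulticut (G₁ ⊔ G₂) S a (F₁ ∪ F₂) := by
  classical
  refine ⟨fun e he => ?_, fun s hs t ht hst => ?_⟩
  · rw [edgeSet_sup]
    exact he.imp (fun h => hF₁.1 h) (fun h => hF₂.1 h)
  let H : Bool → SimpleGraph V := fun i => cond i (G₁.deleteEdges F₁) (G₂.deleteEdges F₂)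
  let W : Bool → Set V := fun i => cond i V₁ V₂
  let b : V → V → ℕ := fun x y => if x = y then 0 else a x y
  have hle : (G₁ ⊔ G₂).deleteEdges (F₁ ∪ F₂) ≤ ⨆ i, H i := by
    intro x y h
    simp only [deleteEdges_adj, sup_adj, Set.mem_union, not_or] at h
    rw [SimpleGraph.iSup_adj]
    rcases h with ⟨h | h, h₁, h₂⟩
    · exact ⟨true, deleteEdges_adj.mpr ⟨h, h₁⟩⟩
    · exact ⟨false, deleteEdges_adj.mpr ⟨h, h₂⟩⟩
  have hW : ∀ i, (H i).support ⊆ W i := by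
    rintro (_ | _)
    · exact (support_mono (deleteEdges_le F₂)).trans hV₂
    · exact (support_mono (deleteEdges_le F₁)).trans hV₁
  have hWS : ∀ i j, i ≠ j → W i ∩ W j ⊆ S := by
    rintro (_ | _) (_ | _) hij x ⟨hi, hj⟩
    · exact absurd rfl hij
    · exact hS ▸ ⟨hj, hi⟩
    · exact hS ▸ ⟨hi, hj⟩
    · exact absurd rfl hij
  have hb_tri : ∀ s ∈ S, ∀ u ∈ S, ∀ t ∈ S, b s t ≤ b s u + b u t := by
    intro s hs u hu t ht
    have := htri s hs t ht u hu
    grind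
  have hb : ∀ i, ∀ s ∈ S, ∀ t ∈ S, (b s t : ℕ∞) ≤ (H i).edist s t := by
    intro i s hs t ht
    by_cases hst : s = t
    · simp [b, hst]
    · rw [show b s t = a s t from if_neg hst]
      cases i
      · exact hF₂.2 s hs t ht hst
      · exact hF₁.2 s hs t ht hst
  have hsW : s ∈ W true := (hS ▸ hs : s ∈ V₁ ∩ V₂).1
  refine le_trans ?_ (edist_anti hle)
  refine le_iInf fun p => ?_
  simpa [b, hst] using le_edist_add_length_of_iSup hW hWS hb_tri hb p ht true hsW hs
end

section
/- Let G1 = (V1, E1) and G2 = (V2, E2) be finite simple graphs that are edge-disjoint, let G = G1 ∪ G2 be their union, let S = V1 ∩ V2, and let a be length constraints on S satisfying the triangle inequalities. Then the minimum size of an a-bounded S-multicut of G equals the minimum size of an a-bounded S-multicut of G1 plus the minimum size of an a-bounded S-multicut of G2; moreover, if F1 and F2 are minimum a-bounded S-multicuts of G1 and G2 respectively, then their (disjoint) union F1 ∪ F2 is a minimum a-bounded S-multicut of G. -/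
open SimpleGraph

/-- The minimum size of an `a`-bounded `S`-multicut of `G`. -/
noncomputable def minMulticutSize {V : Type*} (G : SimpleGraph V) (S : Set V)
    (a : V → V → ℕ) : ℕ :=
  sInf {n : ℕ | ∃ F : Set (Sym2 V), IsLBMulticut G S a F ∧ F.ncard = n}

section WalkBounds

variable {V ι : Type*} {H : ι → SimpleGraph V} {S : Set V} {b : V → V → ℕ}

/-- Suppose graphs `H i` pairwise share only vertices of `S`, and `b` satisfies the triangle
inequality on `S` and bounds from below the length of every walk between vertices of `S` in each
`H i`. Then `b` bounds the length of a walk in some `H i` continued by a walk in `⨆ i, H i`. -/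
theorem le_length_add_length_of_iSup
    (hS : ∀ i j, i ≠ j → (H i).support ∩ (H j).support ⊆ S)
    (htri : ∀ s ∈ S, ∀ t ∈ S, ∀ u ∈ S, b s t ≤ b s u + b u t)
    (hb : ∀ i, ∀ s ∈ S, ∀ t ∈ S, ∀ p : (H i).Walk s t, b s t ≤ p.length)
    {u t : V} (w : (⨆ i, H i).Walk u t) (ht : t ∈ S) {s : V} (hs : s ∈ S) {i : ι}
    (p : (H i).Walk s u) : b s t ≤ p.length + w.length := by
  induction w generalizing s i with
  | nil => simpa using hb i s hs _ ht p
  | @cons u v t h w ih =>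
    obtain ⟨j, hj⟩ := iSup_adj.1 h
    rw [Walk.length_cons]
    by_cases hij : i = j
    · subst hij
      have := ih ht hs (p.concat hj)
      rw [Walk.length_concat] at this
      omega
    · have hu : u ∈ S := by
        cases hp : p.reverse with
        | nil => exact hs
        | cons h' _ => exact hS i j hij ⟨⟨_, h'⟩, ⟨_, hj⟩⟩
      have h₁ := ih ht hu (Walk.cons hj Walk.nil)
      have h₂ := hb i s hs u hu p
      have h₃ := htri s hs t ht u hu
      simp only [Walk.length_cons, Walk.length_nil] at h₁
      omega

end WalkBounds

section Multicut

variable {V : Type*} {G G₁ G₂ : SimpleGraph V} {S : Set V} {a : V → V → ℕ} {F F₁ F₂ : Set (Sym2 V)}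

theorem isLBMulticut_edgeSet (G : SimpleGraph V) (S : Set V) (a : V → V → ℕ) :
    IsLBMulticut G S a G.edgeSet := by
  refine ⟨subset_rfl, fun s _ t _ hst => ?_⟩
  have : G.deleteEdges G.edgeSet = ⊥ := by
    ext; simp
  rw [this, edist_bot_of_ne hst]
  exact le_top

theorem exists_isLBMulticut_ncard_eq (G : SimpleGraph V) (S : Set V) (a : V → V → ℕ) :
    ∃ F, IsLBMulticut G S a F ∧ F.ncard = minMulticutSize G S a :=
  Nat.sInf_mem (s := {n | ∃ F, IsLBMulticut G S a F ∧ F.ncard = n})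
    ⟨_, _, isLBMulticut_edgeSet G S a, rfl⟩

theorem IsLBMulticut.minMulticutSize_le (h : IsLBMulticut G S a F) :
    minMulticutSize G S a ≤ F.ncard :=
  Nat.sInf_le ⟨F, h, rfl⟩

theorem IsLBMulticut.inter_edgeSet (h : IsLBMulticut G S a F) (hle : G₁ ≤ G) :
    IsLBMulticut G₁ S a (F ∩ G₁.edgeSet) := by
  refine ⟨Set.inter_subset_right, fun s hs t ht hst => (h.2 s hs t ht hst).trans (edist_anti ?_)⟩
  intro x y hxy
  simp only [deleteEdges_adj, Set.mem_inter_iff, mem_edgeSet] at hxy ⊢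
  exact ⟨hle hxy.1, fun hF => hxy.2 ⟨hF, hxy.1⟩⟩

/-- Multicuts of two graphs which meet only in terminals combine to a multicut of the union. -/
theorem IsLBMulticut.union (hS : G₁.support ∩ G₂.support ⊆ S)
    (htri : ∀ s ∈ S, ∀ t ∈ S, ∀ u ∈ S, s ≠ t → s ≠ u → t ≠ u → a s t ≤ a s u + a u t)
    (h₁ : IsLBMulticut G₁ S a F₁) (h₂ : IsLBMulticut G₂ S a F₂) :
    IsLBMulticut (G₁ ⊔ G₂) S a (F₁ ∪ F₂) := by
  classical
  refine ⟨by rw [edgeSet_sup]; exact Set.union_subset_union h₁.1 h₂.1, fun s hs t ht hst => ?_⟩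
  let H : Bool → SimpleGraph V := fun i => cond i (G₁.deleteEdges F₁) (G₂.deleteEdges F₂)
  have hle : (G₁ ⊔ G₂).deleteEdges (F₁ ∪ F₂) ≤ ⨆ i, H i := by
    rw [← sup_eq_iSup]
    intro x y hxy
    simp only [deleteEdges_adj, sup_adj, Set.mem_union] at hxy ⊢
    tauto
  refine le_trans (le_iInf fun w => ?_) (edist_anti hle)
  let b : V → V → ℕ := fun x y => if x = y then 0 else a x y
  have key := le_length_add_length_of_iSup (H := H) (S := S) (b := b) ?_ ?_ ?_ w ht hs
    (i := true) Walk.nil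
  · simpa [b, hst] using key
  · have h : (H true).support ∩ (H false).support ⊆ S :=
      (Set.inter_subset_inter (support_mono (deleteEdges_le F₁))
        (support_mono (deleteEdges_le F₂))).trans hS
    rintro (_ | _) (_ | _) hij
    · exact absurd rfl hij
    · rwa [Set.inter_comm]
    · exact h
    · exact absurd rfl hij
  · intro x hx y hy z hz
    have := htri x hx y hy z hz
    grind
  · intro i x hx y hy p
    by_cases hxy : x = y
    · simp [b, hxy]
    · simp only [b, hxy, if_false]
      have : (a x y : ℕ∞) ≤ (H i).edist x y := by
        cases i
        exacts [h₂.2 x hx y hy hxy, h₁.2 x hx y hy hxy]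
      exact_mod_cast this.trans (edist_le p)

theorem minMulticutSize_add_le [Finite V] (hdisj : Disjoint G₁.edgeSet G₂.edgeSet) :
    minMulticutSize G₁ S a + minMulticutSize G₂ S a ≤ minMulticutSize (G₁ ⊔ G₂) S a := by
  obtain ⟨F, hF, hcard⟩ := exists_isLBMulticut_ncard_eq (G₁ ⊔ G₂) S a
  calc minMulticutSize G₁ S a + minMulticutSize G₂ S a
      ≤ (F ∩ G₁.edgeSet).ncard + (F ∩ G₂.edgeSet).ncard :=
        add_le_add (hF.inter_edgeSet le_sup_left).minMulticutSize_le
          (hF.inter_edgeSet le_sup_right).minMulticutSize_le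
    _ = (F ∩ G₁.edgeSet ∪ F ∩ G₂.edgeSet).ncard :=
        (Set.ncard_union_eq (hdisj.mono Set.inter_subset_right Set.inter_subset_right)).symm
    _ ≤ F.ncard := Set.ncard_le_ncard (by simp [← Set.inter_union_distrib_left])
    _ = minMulticutSize (G₁ ⊔ G₂) S a := hcard

end Multicut

/-- If `G₁` and `G₂` are edge-disjoint finite graphs (with vertex sets `V₁`, `V₂`),
`S = V₁ ∩ V₂`, and the length constraints `a` satisfy the triangle inequalities on `S`,
then the minimum size of an `a`-bounded `S`-multicut of `G = G₁ ∪ G₂` equals the sum of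
the minimum sizes for `G₁` and `G₂`; moreover, the union of any minimum `a`-bounded
`S`-multicuts of `G₁` and of `G₂` is a minimum `a`-bounded `S`-multicut of `G`. -/
theorem minMulticut_union_of_edgeDisjoint {V : Type*} [Fintype V]
    (G₁ G₂ : SimpleGraph V) (V₁ V₂ : Set V)
    (hV₁ : G₁.support ⊆ V₁) (hV₂ : G₂.support ⊆ V₂)
    (hdisj : Disjoint G₁.edgeSet G₂.edgeSet)
    (S : Set V) (hS : S = V₁ ∩ V₂)
    (a : V → V → ℕ) (hsym : ∀ s t, a s t = a t s)
    (htri : ∀ s ∈ S, ∀ t ∈ S, ∀ u ∈ S, s ≠ t → s ≠ u → t ≠ u → a s t ≤ a s u + a u t) :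
    minMulticutSize (G₁ ⊔ G₂) S a = minMulticutSize G₁ S a + minMulticutSize G₂ S a ∧
    ∀ F₁ F₂ : Set (Sym2 V),
      IsLBMulticut G₁ S a F₁ → F₁.ncard = minMulticutSize G₁ S a →
      IsLBMulticut G₂ S a F₂ → F₂.ncard = minMulticutSize G₂ S a →
      Disjoint F₁ F₂ ∧ IsLBMulticut (G₁ ⊔ G₂) S a (F₁ ∪ F₂) ∧
        (F₁ ∪ F₂).ncard = minMulticutSize (G₁ ⊔ G₂) S a := by
  have hS' : G₁.support ∩ G₂.support ⊆ S := hS ▸ Set.inter_subset_inter hV₁ hV₂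
  have hunion : ∀ F₁ F₂ : Set (Sym2 V), IsLBMulticut G₁ S a F₁ → IsLBMulticut G₂ S a F₂ →
      Disjoint F₁ F₂ ∧ IsLBMulticut (G₁ ⊔ G₂) S a (F₁ ∪ F₂) ∧
        (F₁ ∪ F₂).ncard = F₁.ncard + F₂.ncard := fun F₁ F₂ h₁ h₂ =>
    have hF := hdisj.mono h₁.1 h₂.1
    ⟨hF, h₁.union hS' htri h₂, Set.ncard_union_eq hF⟩
  have heq : minMulticutSize (G₁ ⊔ G₂) S a = minMulticutSize G₁ S a + minMulticutSize G₂ S a := by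
    refine le_antisymm ?_ (minMulticutSize_add_le hdisj)
    obtain ⟨F₁, h₁, hc₁⟩ := exists_isLBMulticut_ncard_eq G₁ S a
    obtain ⟨F₂, h₂, hc₂⟩ := exists_isLBMulticut_ncard_eq G₂ S a
    obtain ⟨-, hF, hc⟩ := hunion F₁ F₂ h₁ h₂
    rw [← hc₁, ← hc₂, ← hc]
    exact hF.minMulticutSize_le
  refine ⟨heq, fun F₁ F₂ h₁ hc₁ h₂ hc₂ => ?_⟩
  obtain ⟨hd, hF, hc⟩ := hunion F₁ F₂ h₁ h₂
  exact ⟨hd, hF, by rw [hc, hc₁, hc₂, heq]⟩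
end

section
/- Let h ≥ 1 and Q ≥ 1, let B = B(s, t, h, Q) be a butte, and let F ⊆ E(B) be a set of edges containing exactly one edge from each of the h shortcuts of B and no other edges (i.e. F ridges the butte B). Then the distance between s and t in the graph B − F (the graph obtained from B by deleting the edges in F) is exactly h + 2. -/
/-- The vertices of the butte `B(s, t, h, Q)`: the two endpoints `s` and `t`, the midpoint
`sc c` of the `c`-th shortcut (an `s`–`t` path of length `2`), and the `p`-th internal
vertex `rw q p` of the `q`-th ridgeway (an `s`–`t` path of length `h + 2`, having `h + 1`
internal vertices). -/
inductive ButteV (h Q : ℕ) : Type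
  | s : ButteV h Q
  | t : ButteV h Q
  | sc : Fin h → ButteV h Q
  | rw : Fin Q → Fin (h + 1) → ButteV h Q

/-- Generating relation for the edges of the butte. -/
def butteRel (h Q : ℕ) : ButteV h Q → ButteV h Q → Prop
  | .s, .sc _ => True
  | .sc _, .t => True
  | .s, .rw _ p => p.val = 0
  | .rw _ p, .t => p.val = h
  | .rw q p, .rw q' p' => q = q' ∧ p'.val = p.val + 1
  | _, _ => False

/-- The butte `B(s, t, h, Q)`: `h` internally disjoint `s`–`t` paths of length `2`
(shortcuts) and `Q` internally disjoint `s`–`t` paths of length `h + 2` (ridgeways). -/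
def butte (h Q : ℕ) : SimpleGraph (ButteV h Q) :=
  SimpleGraph.fromRel (butteRel h Q)

/-- The two edges of the `c`-th shortcut of the butte. -/
def shortcutEdge₁ {h Q : ℕ} (c : Fin h) : Sym2 (ButteV h Q) := s(ButteV.s, ButteV.sc c)

def shortcutEdge₂ {h Q : ℕ} (c : Fin h) : Sym2 (ButteV h Q) := s(ButteV.sc c, ButteV.t)

/-- A function that grows by at most one along each edge grows along a walk by at most its
length. -/
theorem SimpleGraph.Walk.le_add_length_of_adj {V : Type*} {G : SimpleGraph V} {f : V → ℕ}
    (hf : ∀ u v, G.Adj u v → f v ≤ f u + 1) {u v : V} (w : G.Walk u v) :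
    f v ≤ f u + w.length := by
  induction w with
  | nil => simp
  | cons hadj w ih =>
    have := hf _ _ hadj
    rw [SimpleGraph.Walk.length_cons]
    omega

open Classical in
/-- The potential of a vertex of a ridged butte: its position along a ridgeway, where the
midpoint of a shortcut has the potential of the endpoint it is still attached to. -/
noncomputable def buttePotential {h Q : ℕ} (F : Set (Sym2 (ButteV h Q))) : ButteV h Q → ℕ
  | .s => 0
  | .t => h + 2
  | .sc c => if shortcutEdge₁ c ∈ F then h + 2 else 0
  | .rw _ p => p.val + 1

theorem buttePotential_le_of_adj {h Q : ℕ} {F : Set (Sym2 (ButteV h Q))}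
    (hF : ∀ c : Fin h, shortcutEdge₁ c ∈ F ∨ shortcutEdge₂ c ∈ F) (u v : ButteV h Q)
    (huv : ((butte h Q).deleteEdges F).Adj u v) :
    buttePotential F v ≤ buttePotential F u + 1 := by
  rw [SimpleGraph.deleteEdges_adj, butte, SimpleGraph.fromRel_adj] at huv
  obtain ⟨⟨-, hrel⟩, hmem⟩ := huv
  cases u <;> cases v <;> simp only [butteRel, buttePotential, or_false, false_or] at hrel ⊢ <;>
    first
    | omega
    | (rename_i c
       have := hF c
       simp only [shortcutEdge₁, shortcutEdge₂] at this ⊢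
       first
       | (rw [Sym2.eq_swap] at hmem; simp_all; done)
       | simp_all)

/-- Edges of the butte that avoid the midpoints of the shortcuts survive ridging. -/
theorem adj_deleteEdges_of_butteRel {h Q : ℕ} {F : Set (Sym2 (ButteV h Q))}
    (honly : ∀ e ∈ F, ∃ c : Fin h, e = shortcutEdge₁ c ∨ e = shortcutEdge₂ c)
    {u v : ButteV h Q} (huv : butteRel h Q u v) (hu : ∀ c, u ≠ .sc c) (hv : ∀ c, v ≠ .sc c) :
    ((butte h Q).deleteEdges F).Adj u v := by
  rw [SimpleGraph.deleteEdges_adj, butte, SimpleGraph.fromRel_adj]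
  refine ⟨⟨?_, .inl huv⟩, fun hmem => ?_⟩
  · rintro rfl
    cases u <;> simp [butteRel] at huv
  · obtain ⟨c, hc | hc⟩ := honly _ hmem <;>
      simp [shortcutEdge₁, shortcutEdge₂, hu c, hv c] at hc

/-- Each initial segment of a ridgeway is a walk in the ridged butte. -/
theorem exists_walk_ridgeway {h Q : ℕ} {F : Set (Sym2 (ButteV h Q))}
    (honly : ∀ e ∈ F, ∃ c : Fin h, e = shortcutEdge₁ c ∨ e = shortcutEdge₂ c)
    (q : Fin Q) (p : ℕ) (hp : p < h + 1) :
    ∃ w : ((butte h Q).deleteEdges F).Walk .s (.rw q ⟨p, hp⟩), w.length = p + 1 := by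
  induction p with
  | zero =>
    have hadj : ((butte h Q).deleteEdges F).Adj .s (.rw q ⟨0, hp⟩) :=
      adj_deleteEdges_of_butteRel honly (by simp [butteRel]) (by simp) (by simp)
    exact ⟨hadj.toWalk, rfl⟩
  | succ p ih =>
    obtain ⟨w, hw⟩ := ih (by omega)
    have hadj : ((butte h Q).deleteEdges F).Adj (.rw q ⟨p, by omega⟩) (.rw q ⟨p + 1, hp⟩) :=
      adj_deleteEdges_of_butteRel honly (by simp [butteRel]) (by simp) (by simp)
    exact ⟨w.concat hadj, by rw [SimpleGraph.Walk.length_concat, hw]⟩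

/-- If `h ≥ 1`, `Q ≥ 1` and `F` ridges the butte `B = B(s, t, h, Q)`, i.e. `F` contains
exactly one edge from each of the `h` shortcuts of `B` and no other edges, then the
distance between `s` and `t` in `B − F` is exactly `h + 2`. -/
theorem butte_ridged_edist (h Q : ℕ) (hh : 1 ≤ h) (hQ : 1 ≤ Q)
    (F : Set (Sym2 (ButteV h Q)))
    (hFsub : F ⊆ (butte h Q).edgeSet)
    (hone : ∀ c : Fin h,
      (shortcutEdge₁ c ∈ F ∧ shortcutEdge₂ c ∉ F) ∨
      (shortcutEdge₁ c ∉ F ∧ shortcutEdge₂ c ∈ F))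
    (honly : ∀ e ∈ F, ∃ c : Fin h, e = shortcutEdge₁ c ∨ e = shortcutEdge₂ c) :
    ((butte h Q).deleteEdges F).edist ButteV.s ButteV.t = (h : ℕ∞) + 2 := by
  apply le_antisymm
  · obtain ⟨w, hw⟩ := exists_walk_ridgeway honly ⟨0, hQ⟩ h (Nat.lt_succ_self h)
    have hadj : ((butte h Q).deleteEdges F).Adj (.rw ⟨0, hQ⟩ ⟨h, Nat.lt_succ_self h⟩) .t :=
      adj_deleteEdges_of_butteRel honly (by simp [butteRel]) (by simp) (by simp)
    refine (SimpleGraph.edist_le (w.concat hadj)).trans (le_of_eq ?_)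
    rw [SimpleGraph.Walk.length_concat, hw]
    norm_cast
  · refine le_iInf fun w => ?_
    have hF : ∀ c : Fin h, shortcutEdge₁ c ∈ F ∨ shortcutEdge₂ c ∈ F :=
      fun c => (hone c).imp And.left And.right
    have hlen := w.le_add_length_of_adj (buttePotential_le_of_adj hF)
    simp only [buttePotential, zero_add] at hlen
    exact_mod_cast hlen
end

section
/- Let G = (V, E) be a finite simple graph, let S ⊆ V be a set of terminals, let a be length constraints on S satisfying the triangle inequalities, let F1 ∪ F2 be a union of an a-bounded S-multicut of an edge-disjoint subgraph decomposition as follows: G = G1 ∪ G2 with G1, G2 edge-disjoint and S = V(G1) ∩ V(G2), F1 an a-bounded S-multicut of G1 and F2 an a-bounded S-multicut of G2. Then every path P in G − (F1 ∪ F2) between two distinct terminals s, t ∈ S has length at least a(s,t); the proof is by induction on the number |V(P) ∩ S| of terminals on P: if P is internally disjoint from S then P lies entirely in G1 − F1 or in G2 − F2, and otherwise P splits at an intermediate terminal u into segments of lengths at least a(s,u) and a(u,t), whose sum is at least a(s,t) by the triangle inequalities. -/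
open SimpleGraph

/-- If the graphs `H i` pairwise meet only in terminals and every walk inside a single `H i` between
distinct terminals `s, t` has length at least `a s t`, then so does every concatenation of a walk
inside some `H i` with a walk in a graph covered by the `H i`. -/
theorem le_length_add_length_of_cover {V ι : Type*} {K : SimpleGraph V} {H : ι → SimpleGraph V}
    {S : Set V} {a : V → V → ℕ} (hK : ∀ x y, K.Adj x y → ∃ i, (H i).Adj x y)
    (hHS : ∀ i j, i ≠ j → (H i).support ∩ (H j).support ⊆ S)
    (htri : ∀ s ∈ S, ∀ t ∈ S, ∀ u ∈ S, s ≠ t → s ≠ u → t ≠ u → a s t ≤ a s u + a u t)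
    (hH : ∀ i, ∀ s ∈ S, ∀ t ∈ S, s ≠ t → ∀ Q : (H i).Walk s t, a s t ≤ Q.length)
    {x t : V} (P : K.Walk x t) (ht : t ∈ S) (i : ι) {s : V} (hs : s ∈ S) (hst : s ≠ t)
    (Q : (H i).Walk s x) : a s t ≤ Q.length + P.length := by
  induction P generalizing i s with
  | nil => exact (hH i s hs _ ht hst Q).trans (Nat.le_add_right _ _)
  | @cons x y t hxy P ih =>
    obtain ⟨j, hj⟩ := hK x y hxy
    rw [Walk.length_cons]
    by_cases hij : i = j
    · subst hij
      have h := ih ht i hs hst (Q.concat hj)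
      rw [Walk.length_concat] at h
      omega
    by_cases hxs : s = x
    · subst hxs
      have h := ih ht j hs hst hj.toWalk
      rw [Walk.length_cons, Walk.length_nil] at h
      omega
    have hxi : x ∈ (H i).support := by
      cases hQ : Q.reverse with
      | nil => exact absurd rfl hxs
      | cons h _ => exact ⟨_, h⟩
    have hxS : x ∈ S := hHS i j hij ⟨hxi, y, hj⟩
    have hQ := hH i s hs x hxS hxs Q
    by_cases hxt : x = t
    · subst hxt
      omega
    have h := ih ht j hxS hxt hj.toWalk
    rw [Walk.length_cons, Walk.length_nil] at h
    have := htri s hs t ht x hxS hst hxs (Ne.symm hxt)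
    omega

/-- Let `G = G₁ ∪ G₂` with `G₁, G₂` edge-disjoint (having vertex sets `V₁`, `V₂`),
`S = V₁ ∩ V₂`, `a` length constraints satisfying the triangle inequalities on `S`,
`F₁` an `a`-bounded `S`-multicut of `G₁` and `F₂` an `a`-bounded `S`-multicut of `G₂`.
Then every path `P` in `G − (F₁ ∪ F₂)` between two distinct terminals `s, t ∈ S`
has length at least `a s t`. -/
theorem path_length_ge_of_multicut_union {V : Type*} [Fintype V]
    (G₁ G₂ : SimpleGraph V) (V₁ V₂ : Set V)
    (hV₁ : G₁.support ⊆ V₁) (hV₂ : G₂.support ⊆ V₂)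
    (hdisj : Disjoint G₁.edgeSet G₂.edgeSet)
    (S : Set V) (hS : S = V₁ ∩ V₂)
    (a : V → V → ℕ) (hsym : ∀ s t, a s t = a t s)
    (htri : ∀ s ∈ S, ∀ t ∈ S, ∀ u ∈ S, s ≠ t → s ≠ u → t ≠ u → a s t ≤ a s u + a u t)
    (F₁ F₂ : Set (Sym2 V))
    (hF₁ : IsLBMulticut G₁ S a F₁) (hF₂ : IsLBMulticut G₂ S a F₂)
    (s t : V) (hs : s ∈ S) (ht : t ∈ S) (hst : s ≠ t)
    (P : ((G₁ ⊔ G₂).deleteEdges (F₁ ∪ F₂)).Walk s t) (hP : P.IsPath) :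
    a s t ≤ P.length := by
  have hsub : ∀ x, x ∈ (G₁.deleteEdges F₁).support → x ∈ (G₂.deleteEdges F₂).support → x ∈ S :=
    fun x h₁ h₂ => hS ▸ ⟨hV₁ (support_mono (deleteEdges_le F₁) h₁),
      hV₂ (support_mono (deleteEdges_le F₂) h₂)⟩
  have h := le_length_add_length_of_cover (S := S) (a := a)
    (H := fun b : Bool => if b then G₁.deleteEdges F₁ else G₂.deleteEdges F₂)
    (fun x y hxy => ?_) (fun i j hij x hx => ?_) htri (fun i u hu v hv huv Q => ?_)
    P ht true hs hst Walk.nil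
  · simpa using h
  · simp only [deleteEdges_adj, sup_adj, Set.mem_union, not_or] at hxy
    rcases hxy with ⟨h₁ | h₂, hn₁, hn₂⟩
    · exact ⟨true, by simp [h₁, hn₁]⟩
    · exact ⟨false, by simp [h₂, hn₂]⟩
  · cases i <;> cases j
    · exact absurd rfl hij
    · exact hsub x hx.2 hx.1
    · exact hsub x hx.1 hx.2
    · exact absurd rfl hij
  · cases i
    · exact_mod_cast (hF₂.2 u hu v hv huv).trans (Walk.edist_le Q)
    · exact_mod_cast (hF₁.2 u hu v hv huv).trans (Walk.edist_le Q)
end
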